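/- arXiv:1904.03174 — 4 statements merged into one kernel-verified Lean document; each statement's English description precedes it below -/
import Mathlib

section
/- λ = 0 is not an eigenvalue of the linearization about the critical pulled front in the exponentially weighted space (Lemma B.1): suppose (v₁, v₂) : ℝ → ℝ² is a C² function satisfying pointwise v₁'' + c*v₁' + (1 − 2U* − aV*)v₁ − aU*v₂ = 0 and σv₂'' + c*v₂' − rbV*v₁ + r(1 − bU* − 2V*)v₂ = 0 on ℝ, such that v₁/ω and v₂/ω are bounded on ℝ and v₁(x)/ω(x) → 0 and v₂(x)/ω(x) → 0 as x → ±∞. Then v₁ ≡ 0 and v₂ ≡ 0. -/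
open Filter

lemma znE_second {z z' : ℝ → ℝ} {x y : ℝ} (h1 : ∀ x, HasDerivAt z (z' x) x)
    (h2 : HasDerivAt z' y x) (hm : IsLocalMax z x) : z' x = 0 ∧ y ≤ 0 := by
  have h0 : z' x = 0 := hm.hasDerivAt_eq_zero (h1 x)
  refine ⟨h0, ?_⟩
  by_contra hy
  push Not at hy
  have hd : deriv z = z' := funext fun t => (h1 t).deriv
  have hmin : IsLocalMin z x := by
    apply isLocalMin_of_deriv_deriv_pos
    · rw [hd, h2.deriv]; exact hy
    · rw [hd, h0]
    · exact (h1 x).continuousAt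
  have hc : z =ᶠ[nhds x] fun _ => z x := by
    filter_upwards [hm, hmin] with t ht1 ht2
    exact le_antisymm ht1 ht2
  have hc2 := hc.deriv
  rw [hd] at hc2
  have := hc2.deriv_eq
  rw [h2.deriv] at this
  simp at this
  linarith

lemma znE_touch {z z' z'' : ℝ → ℝ} {α D x0 : ℝ} (hα : 0 < α)
    (h1 : ∀ x, HasDerivAt z (z' x) x) (h2 : ∀ x, HasDerivAt z' (z'' x) x)
    (hz0 : z x0 = 0) (hz1 : z' x0 = 0)
    (hnn : ∀ x, 0 ≤ z x) (hle : ∀ x, z'' x + α * z' x - D * z x ≤ 0) :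
    ∀ x, x0 ≤ x → z x = 0 := by
  obtain ⟨l, hl0, hl⟩ : ∃ l : ℝ, 0 < l ∧ D ≤ l * (l + α) := by
    refine ⟨|D| + 1, by positivity, ?_⟩
    nlinarith [le_abs_self D, abs_nonneg D]
  have hA : ∀ x, HasDerivAt (fun x => Real.exp ((α + l) * x) * (z' x - l * z x))
      (Real.exp ((α + l) * x) * (z'' x + α * z' x - l * (l + α) * z x)) x := by
    intro x
    have e : HasDerivAt (fun x => Real.exp ((α + l) * x)) (Real.exp ((α + l) * x) * (α + l)) x := by
      simpa using ((hasDerivAt_id x).const_mul (α + l)).exp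
    have := e.mul ((h2 x).sub ((h1 x).const_mul l))
    exact this.congr_deriv (by simp only [Pi.sub_apply]; ring)
  have hanti : Antitone (fun x => Real.exp ((α + l) * x) * (z' x - l * z x)) := by
    apply antitone_of_hasDerivAt_nonpos hA
    intro x
    apply mul_nonpos_of_nonneg_of_nonpos (Real.exp_pos _).le
    have := mul_le_mul_of_nonneg_right hl (hnn x)
    linarith [hle x]
  have hs : ∀ x, x0 ≤ x → z' x - l * z x ≤ 0 := by
    intro x hx
    have := hanti hx
    simp only [hz0, hz1, mul_zero, sub_zero] at this
    by_contra h
    push Not at h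
    linarith [mul_pos (Real.exp_pos ((α + l) * x)) h]
  have hB : ∀ x, HasDerivAt (fun x => Real.exp (-l * x) * z x)
      (Real.exp (-l * x) * (z' x - l * z x)) x := by
    intro x
    have e : HasDerivAt (fun x => Real.exp (-l * x)) (Real.exp (-l * x) * (-l)) x := by
      simpa using ((hasDerivAt_id x).const_mul (-l)).exp
    have := e.mul (h1 x)
    exact this.congr_deriv (by ring)
  have hanti2 : AntitoneOn (fun x => Real.exp (-l * x) * z x) (Set.Ici x0) := by
    apply antitoneOn_of_deriv_nonpos (convex_Ici x0)
    · exact fun x _ => (hB x).continuousAt.continuousWithinAt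
    · exact fun x _ => (hB x).differentiableAt.differentiableWithinAt
    · intro x hx
      rw [interior_Ici] at hx
      rw [(hB x).deriv]
      exact mul_nonpos_of_nonneg_of_nonpos (Real.exp_pos _).le (hs x (le_of_lt hx))
  intro x hx
  have := hanti2 (Set.mem_Ici.2 le_rfl) hx hx
  simp only [hz0, mul_zero] at this
  apply le_antisymm _ (hnn x)
  by_contra h
  push Not at h
  linarith [mul_pos (Real.exp_pos (-l * x)) h]

lemma znE_left {z1 z1' z1'' z2 z2' z2'' d1 e1 d2 e2 u1 u2 : ℝ → ℝ} {α1 α2 X : ℝ}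
    (h1 : ∀ x, HasDerivAt z1 (z1' x) x) (h1' : ∀ x, HasDerivAt z1' (z1'' x) x)
    (h2 : ∀ x, HasDerivAt z2 (z2' x) x) (h2' : ∀ x, HasDerivAt z2' (z2'' x) x)
    (q1 : ∀ x, z1'' x + α1 * z1' x + d1 x * z1 x + e1 x * z2 x = 0)
    (q2 : ∀ x, z2'' x + α2 * z2' x + d2 x * z2 x + e2 x * z1 x = 0)
    (he1 : ∀ x, 0 ≤ e1 x) (he2 : ∀ x, 0 ≤ e2 x)
    (s1 : ∀ x ≤ X, d1 x + e1 x < 0) (s2 : ∀ x ≤ X, d2 x + e2 x < 0)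
    (hu1 : Tendsto u1 atBot (nhds 0)) (hu2 : Tendsto u2 atBot (nhds 0))
    (hzu1 : ∀ x, z1 x ≤ u1 x) (hzu2 : ∀ x, z2 x ≤ u2 x)
    (b1 : z1 X ≤ 0) (b2 : z2 X ≤ 0) : ∀ x ≤ X, z1 x ≤ 0 ∧ z2 x ≤ 0 := by
  intro y hy
  rw [← max_le_iff]
  by_contra hpos
  push Not at hpos
  set m : ℝ → ℝ := fun x => max (z1 x) (z2 x) with hm
  have hcont : Continuous m :=
    (continuous_iff_continuousAt.2 fun x => (h1 x).continuousAt).max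
      (continuous_iff_continuousAt.2 fun x => (h2 x).continuousAt)
  have hpos : 0 < m y := hpos
  have hev : ∀ᶠ x in atBot, u1 x < m y ∧ u2 x < m y ∧ x < y :=
    (hu1.eventually_lt_const hpos).and ((hu2.eventually_lt_const hpos).and (eventually_lt_atBot y))
  obtain ⟨Y, hY1, hY2, hYy⟩ := hev.exists
  obtain ⟨x0, hx0, hmax⟩ := isCompact_Icc.exists_isMaxOn (s := Set.Icc Y X) ⟨y, hYy.le, hy⟩
    hcont.continuousOn
  have hge : m y ≤ m x0 := hmax ⟨hYy.le, hy⟩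
  have hmp : 0 < m x0 := lt_of_lt_of_le hpos hge
  have hxY : x0 ≠ Y := by
    rintro rfl
    have : m x0 < m y := max_lt ((hzu1 _).trans_lt hY1) ((hzu2 _).trans_lt hY2)
    linarith
  have hxX : x0 ≠ X := by
    rintro rfl
    have : m x0 ≤ 0 := max_le b1 b2
    linarith
  have hnb : Set.Icc Y X ∈ nhds x0 :=
    Icc_mem_nhds (lt_of_le_of_ne hx0.1 hxY.symm) (lt_of_le_of_ne hx0.2 hxX)
  have hl1 : z1 x0 ≤ m x0 := le_max_left _ _
  have hl2 : z2 x0 ≤ m x0 := le_max_right _ _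
  rcases max_choice (z1 x0) (z2 x0) with hch | hch
  · have hch : m x0 = z1 x0 := hch
    have hloc : IsLocalMax z1 x0 := by
      filter_upwards [hnb] with t ht
      rw [← hch]
      exact (le_max_left _ _).trans (hmax ht)
    obtain ⟨k1, k2⟩ := znE_second h1 (h1' x0) hloc
    have := q1 x0
    rw [k1] at this
    have t1 := mul_le_mul_of_nonneg_left hl2 (he1 x0)
    have t2 := mul_neg_of_neg_of_pos (s1 x0 hx0.2) hmp
    rw [← hch] at this
    linarith
  · have hch : m x0 = z2 x0 := hch
    have hloc : IsLocalMax z2 x0 := by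
      filter_upwards [hnb] with t ht
      rw [← hch]
      exact (le_max_right _ _).trans (hmax ht)
    obtain ⟨k1, k2⟩ := znE_second h2 (h2' x0) hloc
    have := q2 x0
    rw [k1] at this
    have t1 := mul_le_mul_of_nonneg_left hl1 (he2 x0)
    have t2 := mul_neg_of_neg_of_pos (s2 x0 hx0.2) hmp
    rw [← hch] at this
    linarith

lemma znE_contact {w w' w'' p p' p'' d : ℝ → ℝ} {α D K x0 : ℝ} (hα : 0 < α) (hK : 0 < K)
    (h1 : ∀ x, HasDerivAt w (w' x) x) (h1' : ∀ x, HasDerivAt w' (w'' x) x)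
    (h2 : ∀ x, HasDerivAt p (p' x) x) (h2' : ∀ x, HasDerivAt p' (p'' x) x)
    (hp : ∀ x, 0 < p x) (hd : ∀ x, -D ≤ d x)
    (hle : ∀ x, w x ≤ K * p x) (heq : w x0 = K * p x0)
    (hq : ∀ x, (K * p'' x - w'' x) + α * (K * p' x - w' x) + d x * (K * p x - w x) ≤ 0)
    (hlim : Tendsto (fun x => w x / p x) atTop (nhds 0)) : False := by
  have g1 : ∀ x, HasDerivAt (fun x => K * p x - w x) (K * p' x - w' x) x :=
    fun x => ((h2 x).const_mul K).sub (h1 x)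
  have g2 : ∀ x, HasDerivAt (fun x => K * p' x - w' x) (K * p'' x - w'' x) x :=
    fun x => ((h2' x).const_mul K).sub (h1' x)
  have hmin : IsLocalMin (fun x => K * p x - w x) x0 := by
    apply Filter.Eventually.of_forall
    intro t
    have := hle t
    simp only [heq]
    linarith
  have hz := znE_touch (D := D) hα g1 g2 (by simp only [heq, sub_self])
    (hmin.hasDerivAt_eq_zero (g1 x0)) (fun x => sub_nonneg.2 (hle x)) (by
      intro x
      have := mul_le_mul_of_nonneg_right (hd x) (sub_nonneg.2 (hle x))
      linarith [hq x])
  obtain ⟨x, hx1, hx2⟩ := ((hlim.eventually_lt_const hK).and (eventually_ge_atTop x0)).exists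
  have h := hz x hx2
  rw [div_lt_iff₀ (hp x)] at hx1
  linarith

lemma znE_core {w1 w1' w1'' w2 w2' w2'' p1 p1' p1'' p2 p2' p2'' d1 e1 d2 e2 : ℝ → ℝ}
    {α1 α2 X D1 D2 : ℝ} (hα1 : 0 < α1) (hα2 : 0 < α2)
    (h1 : ∀ x, HasDerivAt w1 (w1' x) x) (h1' : ∀ x, HasDerivAt w1' (w1'' x) x)
    (h2 : ∀ x, HasDerivAt w2 (w2' x) x) (h2' : ∀ x, HasDerivAt w2' (w2'' x) x)
    (g1 : ∀ x, HasDerivAt p1 (p1' x) x) (g1' : ∀ x, HasDerivAt p1' (p1'' x) x)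
    (g2 : ∀ x, HasDerivAt p2 (p2' x) x) (g2' : ∀ x, HasDerivAt p2' (p2'' x) x)
    (q1 : ∀ x, w1'' x + α1 * w1' x + d1 x * w1 x + e1 x * w2 x = 0)
    (q2 : ∀ x, w2'' x + α2 * w2' x + d2 x * w2 x + e2 x * w1 x = 0)
    (r1 : ∀ x, p1'' x + α1 * p1' x + d1 x * p1 x + e1 x * p2 x = 0)
    (r2 : ∀ x, p2'' x + α2 * p2' x + d2 x * p2 x + e2 x * p1 x = 0)
    (hp1 : ∀ x, 0 < p1 x) (hp2 : ∀ x, 0 < p2 x)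
    (he1 : ∀ x, 0 ≤ e1 x) (he2 : ∀ x, 0 ≤ e2 x)
    (hd1 : ∀ x, -D1 ≤ d1 x) (hd2 : ∀ x, -D2 ≤ d2 x)
    (s1 : ∀ x ≤ X, d1 x + e1 x < 0) (s2 : ∀ x ≤ X, d2 x + e2 x < 0)
    (hb1 : Tendsto w1 atBot (nhds 0)) (hb2 : Tendsto w2 atBot (nhds 0))
    (ht1 : Tendsto (fun x => w1 x / p1 x) atTop (nhds 0))
    (ht2 : Tendsto (fun x => w2 x / p2 x) atTop (nhds 0)) : ∀ x, w1 x ≤ 0 ∧ w2 x ≤ 0 := by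
  -- extension to the left
  have left : ∀ K : ℝ, 0 ≤ K → w1 X ≤ K * p1 X → w2 X ≤ K * p2 X →
      ∀ x ≤ X, w1 x ≤ K * p1 x ∧ w2 x ≤ K * p2 x := by
    intro K hK hX1 hX2 x hx
    have := znE_left (z1 := fun x => w1 x - K * p1 x) (z2 := fun x => w2 x - K * p2 x)
      (fun x => (h1 x).sub ((g1 x).const_mul K)) (fun x => (h1' x).sub ((g1' x).const_mul K))
      (fun x => (h2 x).sub ((g2 x).const_mul K)) (fun x => (h2' x).sub ((g2' x).const_mul K))
      (d1 := d1) (e1 := e1) (d2 := d2) (e2 := e2) (α1 := α1) (α2 := α2)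
      (fun x => by linear_combination q1 x - K * r1 x)
      (fun x => by linear_combination q2 x - K * r2 x) he1 he2 s1 s2 hb1 hb2
      (fun x => by have := mul_nonneg hK (hp1 x).le; linarith)
      (fun x => by have := mul_nonneg hK (hp2 x).le; linarith)
      (by linarith) (by linarith) x hx
    exact ⟨by linarith, by linarith⟩
  set m : ℝ → ℝ := fun x => max (w1 x / p1 x) (w2 x / p2 x) with hm
  have hcont : Continuous m := by
    apply continuous_iff_continuousAt.2
    intro x
    exact ((h1 x).continuousAt.div (g1 x).continuousAt (hp1 x).ne').max
      ((h2 x).continuousAt.div (g2 x).continuousAt (hp2 x).ne')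
  have hmlim : Tendsto m atTop (nhds 0) := by simpa using ht1.max ht2
  have hw : ∀ K x, m x ≤ K → w1 x ≤ K * p1 x ∧ w2 x ≤ K * p2 x := by
    intro K x h
    obtain ⟨ha, hb⟩ := max_le_iff.1 h
    exact ⟨(div_le_iff₀ (hp1 x)).1 ha, (div_le_iff₀ (hp2 x)).1 hb⟩
  by_cases hcase : ∀ x, X ≤ x → m x ≤ 0
  · intro x
    rcases le_total X x with hx | hx
    · simpa using hw 0 x (hcase x hx)
    · have := hw 0 X (hcase X le_rfl)
      simpa using left 0 le_rfl this.1 this.2 x hx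
  exfalso
  push Not at hcase
  obtain ⟨y, hXy, hy⟩ := hcase
  obtain ⟨Y, hY⟩ := eventually_atTop.1 (hmlim.eventually_lt_const hy)
  have hyY : y ≤ max Y y := le_max_right _ _
  obtain ⟨x0, hx0, hmax⟩ := isCompact_Icc.exists_isMaxOn (s := Set.Icc X (max Y y))
    ⟨y, hXy, hyY⟩ hcont.continuousOn
  have hge : m y ≤ m x0 := hmax ⟨hXy, hyY⟩
  have hK : 0 < m x0 := hy.trans_le hge
  have hright : ∀ x, X ≤ x → m x ≤ m x0 := by
    intro x hx
    rcases le_total x (max Y y) with h | h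
    · exact hmax ⟨hx, h⟩
    · exact (hY x ((le_max_left _ _).trans h)).le.trans hge
  have hall : ∀ x, w1 x ≤ m x0 * p1 x ∧ w2 x ≤ m x0 * p2 x := by
    intro x
    rcases le_total X x with hx | hx
    · exact hw _ x (hright x hx)
    · have := hw _ X (hright X le_rfl)
      exact left _ hK.le this.1 this.2 x hx
  rcases max_choice (w1 x0 / p1 x0) (w2 x0 / p2 x0) with hch | hch
  · refine znE_contact (x0 := x0) (d := d1) (D := D1) hα1 hK h1 h1' g1 g1' hp1 hd1
      (fun x => (hall x).1) ?_ ?_ ht1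
    · have hch : m x0 = w1 x0 / p1 x0 := hch
      rw [hch, div_mul_cancel₀ _ (hp1 x0).ne']
    · intro x
      have := mul_nonneg (he1 x) (sub_nonneg.2 (hall x).2)
      linear_combination this + m x0 * r1 x - q1 x
  · refine znE_contact (x0 := x0) (d := d2) (D := D2) hα2 hK h2 h2' g2 g2' hp2 hd2
      (fun x => (hall x).2) ?_ ?_ ht2
    · have hch : m x0 = w2 x0 / p2 x0 := hch
      rw [hch, div_mul_cancel₀ _ (hp2 x0).ne']
    · intro x
      have := mul_nonneg (he2 x) (sub_nonneg.2 (hall x).1)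
      linear_combination this + m x0 * r2 x - q2 x

lemma znE_ratio {w p ω : ℝ → ℝ} {γ β : ℝ} (hβ : 0 < β)
    (hω : ∀ x ≥ (1:ℝ), ω x = Real.exp (-γ * x))
    (hp : Tendsto (fun x => Real.exp (γ * x) * p x / x) atTop (nhds β))
    (hw : Tendsto (fun x => w x / ω x) atTop (nhds 0)) :
    Tendsto (fun x => w x / p x) atTop (nhds 0) := by
  have h := (hw.mul tendsto_inv_atTop_zero).div hp hβ.ne'
  simp only [mul_zero, zero_div] at h
  refine h.congr' ?_
  filter_upwards [eventually_ge_atTop 1] with x hx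
  have hx0 : x ≠ 0 := by positivity
  simp only [Pi.div_apply]
  rw [hω x hx, neg_mul, Real.exp_neg]
  have := Real.exp_ne_zero (γ * x)
  by_cases hpx : p x = 0
  · simp [hpx]
  field_simp

lemma znE_bot {w ω : ℝ → ℝ} {δ : ℝ} (hδ : 0 < δ)
    (hω : ∀ x ≤ (-1:ℝ), ω x = Real.exp (δ * x))
    (hw : Tendsto (fun x => w x / ω x) atBot (nhds 0)) : Tendsto w atBot (nhds 0) := by
  have he : Tendsto (fun x => Real.exp (δ * x)) atBot (nhds 0) :=
    Real.tendsto_exp_atBot.comp (tendsto_id.const_mul_atBot hδ)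
  have h := hw.mul he
  simp only [mul_zero] at h
  refine h.congr' ?_
  filter_upwards [eventually_le_atBot (-1)] with x hx
  rw [hω x hx, div_mul_cancel₀ _ (Real.exp_ne_zero _)]

lemma znE_c2 {f : ℝ → ℝ} (h : ContDiff ℝ 2 f) :
    (∀ x, HasDerivAt f (deriv f x) x) ∧ (∀ x, HasDerivAt (deriv f) (deriv (deriv f) x) x) := by
  have h' : ContDiff ℝ 1 (deriv f) := by
    have : ContDiff ℝ (1 + 1) f := by simpa [one_add_one_eq_two] using h
    exact (contDiff_succ_iff_deriv.1 this).2.2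
  exact ⟨fun x => (h.differentiable (by norm_num) x).hasDerivAt,
    fun x => (h'.differentiable (by norm_num) x).hasDerivAt⟩

/-- Lemma B.1: `λ = 0` is not an eigenvalue of the linearization about the
critical pulled front in the exponentially weighted space. -/
theorem zero_not_eigenvalue
    -- parameters
    (a b σ r : ℝ)
    (ha0 : 0 < a) (ha1 : a < 1) (hb : 1 < b) (hr : 0 < r)
    (hσ0 : 0 < σ) (hσ2 : σ < 2)
    (hpar : (a * b - max 1 (2 * (1 - a))) * r ≤ max 1 (2 * (1 - a)) * (2 - σ) * (1 - a))
    (γ c δ : ℝ)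
    (hγ : γ = Real.sqrt (1 - a)) (hc : c = 2 * γ)
    (hδ0 : 0 < δ)
    (hδ : δ < min (-γ + Real.sqrt (γ ^ 2 + 1))
        ((-γ + Real.sqrt (γ ^ 2 + σ * r * (b - 1))) / σ))
    -- the weight
    (ω : ℝ → ℝ) (hωsmooth : ContDiff ℝ (⊤ : ℕ∞) ω) (hωpos : ∀ x, 0 < ω x)
    (hωright : ∀ x ≥ (1:ℝ), ω x = Real.exp (-γ * x))
    (hωleft : ∀ x ≤ (-1:ℝ), ω x = Real.exp (δ * x))
    -- the critical pulled front
    (U V : ℝ → ℝ) (hUreg : ContDiff ℝ 2 U) (hVreg : ContDiff ℝ 2 V)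
    (hUode : ∀ x, deriv (deriv U) x + c * deriv U x + U x * (1 - U x - a * V x) = 0)
    (hVode : ∀ x, σ * deriv (deriv V) x + c * deriv V x + r * V x * (1 - b * U x - V x) = 0)
    (hlimbot : Tendsto (fun x => (U x, V x)) atBot (nhds (1, 0)))
    (hlimtop : Tendsto (fun x => (U x, V x)) atTop (nhds (0, 1)))
    (hU01 : ∀ x, 0 < U x ∧ U x < 1) (hV01 : ∀ x, 0 < V x ∧ V x < 1)
    (hUdec : ∀ x, deriv U x < 0) (hVinc : ∀ x, 0 < deriv V x)
    -- weak exponential asymptotics of the derivative of the front at +∞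
    (hasymp : ∃ β₁ β₂ : ℝ, 0 < β₁ ∧ 0 < β₂ ∧
      Tendsto (fun x => Real.exp (γ * x) * (-deriv U x) / x) atTop (nhds β₁) ∧
      Tendsto (fun x => Real.exp (γ * x) * deriv V x / x) atTop (nhds β₂))
    -- a bounded, weighted-decaying solution of the eigenvalue problem at λ = 0
    (v₁ v₂ : ℝ → ℝ) (hv₁reg : ContDiff ℝ 2 v₁) (hv₂reg : ContDiff ℝ 2 v₂)
    (heq₁ : ∀ x, deriv (deriv v₁) x + c * deriv v₁ x
      + (1 - 2 * U x - a * V x) * v₁ x - a * U x * v₂ x = 0)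
    (heq₂ : ∀ x, σ * deriv (deriv v₂) x + c * deriv v₂ x
      - r * b * V x * v₁ x + r * (1 - b * U x - 2 * V x) * v₂ x = 0)
    (hbdd : ∃ B : ℝ, ∀ x, |v₁ x / ω x| ≤ B ∧ |v₂ x / ω x| ≤ B)
    (hlim₁top : Tendsto (fun x => v₁ x / ω x) atTop (nhds 0))
    (hlim₁bot : Tendsto (fun x => v₁ x / ω x) atBot (nhds 0))
    (hlim₂top : Tendsto (fun x => v₂ x / ω x) atTop (nhds 0))
    (hlim₂bot : Tendsto (fun x => v₂ x / ω x) atBot (nhds 0)) :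
    ∀ x : ℝ, v₁ x = 0 ∧ v₂ x = 0 := by
  have hγ0 : 0 < γ := by rw [hγ]; exact Real.sqrt_pos.2 (by linarith)
  have hc0 : 0 < c := by linarith
  obtain ⟨β₁, β₂, hβ1, hβ2, hA1, hA2⟩ := hasymp
  obtain ⟨hU1, hU2⟩ := znE_c2 hUreg
  obtain ⟨hV1, hV2⟩ := znE_c2 hVreg
  obtain ⟨k1, k1'⟩ := znE_c2 hv₁reg
  obtain ⟨k2, k2'⟩ := znE_c2 hv₂reg
  have hUb : Tendsto U atBot (nhds 1) := (continuous_fst.tendsto _).comp hlimbot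
  have hVb : Tendsto V atBot (nhds 0) := (continuous_snd.tendsto _).comp hlimbot
  -- third derivatives of the front
  have hU3 : ∀ x, HasDerivAt (deriv (deriv U))
      (-(c * deriv (deriv U) x) - (deriv U x * (1 - U x - a * V x)
        + U x * (-deriv U x - a * deriv V x))) x := by
    intro x
    have e : deriv (deriv U) = fun x => -(c * deriv U x) - U x * (1 - U x - a * V x) := by
      funext t; linarith [hUode t]
    have := ((hU2 x).const_mul c).neg.sub
      ((hU1 x).mul (((hU1 x).const_sub 1).sub ((hV1 x).const_mul a)))
    change HasDerivAt (fun x => -(c * deriv U x) - U x * (1 - U x - a * V x)) _ x at this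
    rw [← e] at this
    exact this
  have hV3 : ∀ x, HasDerivAt (deriv (deriv V))
      ((-(c * deriv (deriv V) x) - (r * deriv V x * (1 - b * U x - V x)
        + r * V x * (-(b * deriv U x) - deriv V x))) / σ) x := by
    intro x
    have e : deriv (deriv V) = fun x => (-(c * deriv V x) - r * V x * (1 - b * U x - V x)) / σ := by
      funext t
      rw [eq_div_iff hσ0.ne']
      linarith [hVode t]
    have := (((hV2 x).const_mul c).neg.sub
      (((hV1 x).const_mul r).mul ((((hU1 x).const_mul b).const_sub 1).sub (hV1 x)))).div_const σ
    change HasDerivAt (fun x => (-(c * deriv V x) - r * V x * (1 - b * U x - V x)) / σ) _ x at this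
    rw [← e] at this
    exact this
  -- the constant supersolution near minus infinity
  have hs1 : ∀ᶠ x in atBot, (1 - 2 * U x - a * V x) + a * U x < 0 := by
    have : Tendsto (fun x => (1 - 2 * U x - a * V x) + a * U x) atBot
        (nhds ((1 - 2 * 1 - a * 0) + a * 1)) :=
      ((tendsto_const_nhds.sub (hUb.const_mul 2)).sub (hVb.const_mul a)).add (hUb.const_mul a)
    exact this.eventually_lt_const (by linarith)
  have hs2 : ∀ᶠ x in atBot, r * (1 - b * U x - 2 * V x) / σ + r * b * V x / σ < 0 := by
    have : Tendsto (fun x => r * (1 - b * U x - 2 * V x) / σ + r * b * V x / σ) atBot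
        (nhds (r * (1 - b * 1 - 2 * 0) / σ + r * b * 0 / σ)) :=
      ((((tendsto_const_nhds.sub (hUb.const_mul b)).sub (hVb.const_mul 2)).const_mul r).div_const
        σ).add ((hVb.const_mul (r * b)).div_const σ)
    refine this.eventually_lt_const ?_
    have : r * (1 - b) < 0 := mul_neg_of_pos_of_neg hr (by linarith)
    have := div_neg_of_neg_of_pos this hσ0
    simpa using this
  obtain ⟨X, hX⟩ := eventually_atBot.1 (hs1.and hs2)
  have hrat1 := znE_ratio hβ1 hωright hA1 hlim₁top
  have hrat2 := znE_ratio hβ2 hωright hA2 hlim₂top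
  have hbot1 := znE_bot hδ0 hωleft hlim₁bot
  have hbot2 := znE_bot hδ0 hωleft hlim₂bot
  have he1 : ∀ x, 0 ≤ a * U x := fun x => mul_nonneg ha0.le (hU01 x).1.le
  have he2 : ∀ x, 0 ≤ r * b * V x / σ := fun x =>
    div_nonneg (mul_nonneg (mul_nonneg hr.le (by linarith)) (hV01 x).1.le) hσ0.le
  have hd1 : ∀ x, -(2 : ℝ) ≤ 1 - 2 * U x - a * V x := fun x => by
    have := (hU01 x).2
    have h1 := (hV01 x).2
    have h2 := (hV01 x).1
    nlinarith
  have hd2 : ∀ x, -(r * (b + 1) / σ) ≤ r * (1 - b * U x - 2 * V x) / σ := fun x => by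
    rw [← neg_div]
    apply div_le_div_of_nonneg_right _ hσ0.le
    have := (hU01 x).2
    have h1 := (hV01 x).2
    have : -(b + 1) ≤ 1 - b * U x - 2 * V x := by nlinarith
    have := mul_le_mul_of_nonneg_left this hr.le
    linarith
  have hr1 : ∀ x, -(-(c * deriv (deriv U) x) - (deriv U x * (1 - U x - a * V x)
        + U x * (-deriv U x - a * deriv V x))) + c * (-deriv (deriv U) x)
        + (1 - 2 * U x - a * V x) * (-deriv U x) + a * U x * deriv V x = 0 := fun x => by ring
  have hr2 : ∀ x, (-(c * deriv (deriv V) x) - (r * deriv V x * (1 - b * U x - V x)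
        + r * V x * (-(b * deriv U x) - deriv V x))) / σ + c / σ * deriv (deriv V) x
        + r * (1 - b * U x - 2 * V x) / σ * deriv V x + r * b * V x / σ * (-deriv U x) = 0 :=
    fun x => by field_simp; ring
  have hcσ : 0 < c / σ := div_pos hc0 hσ0
  have pos := znE_core hc0 hcσ k1 k1' (fun x => (k2 x).neg) (fun x => (k2' x).neg)
    (fun x => (hU2 x).neg) (fun x => (hU3 x).neg) hV2 hV3
    (fun x => by simp only [Pi.neg_apply]; linear_combination heq₁ x)
    (fun x => by
      simp only [Pi.neg_apply]
      have := heq₂ x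
      field_simp
      linear_combination -this)
    hr1 hr2 (fun x => neg_pos.2 (hUdec x)) hVinc he1 he2 hd1 hd2
    (fun x hx => (hX x hx).1) (fun x hx => (hX x hx).2) hbot1 (by have h := hbot2.neg; rw [neg_zero] at h; exact h)
    hrat1 (by simpa [neg_div] using hrat2.neg)
  have neg := znE_core hc0 hcσ (fun x => (k1 x).neg) (fun x => (k1' x).neg) k2 k2'
    (fun x => (hU2 x).neg) (fun x => (hU3 x).neg) hV2 hV3
    (fun x => by simp only [Pi.neg_apply]; linear_combination -heq₁ x)
    (fun x => by
      simp only [Pi.neg_apply]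
      have := heq₂ x
      field_simp
      linear_combination this)
    hr1 hr2 (fun x => neg_pos.2 (hUdec x)) hVinc he1 he2 hd1 hd2
    (fun x hx => (hX x hx).1) (fun x hx => (hX x hx).2) (by have h := hbot1.neg; rw [neg_zero] at h; exact h) hbot2
    (by simpa [neg_div] using hrat1.neg) hrat2
  intro x
  have p := pos x
  have n := neg x
  simp only [Pi.neg_apply] at p n
  exact ⟨by linarith, by linarith⟩
end

section
/- All real point spectrum of the weighted linearization is strictly negative (Lemma B.2): let λ ∈ ℝ and suppose (v₁, v₂) : ℝ → ℝ² is a C² function, not identically (0,0), satisfying pointwise v₁'' + c*v₁' + (1 − 2U* − aV*)v₁ − aU*v₂ = λv₁ and σv₂'' + c*v₂' − rbV*v₁ + r(1 − bU* − 2V*)v₂ = λv₂ on ℝ, such that v₁/ω and v₂/ω are bounded on ℝ and v₁(x)/ω(x) → 0 and v₂(x)/ω(x) → 0 as x → ±∞. Then λ < 0. -/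
open Filter

lemma aux_second {y y' : ℝ → ℝ} {y'' x0 : ℝ} (h1 : ∀ x, HasDerivAt y (y' x) x)
    (h2 : HasDerivAt y' y'' x0) (hm : IsLocalMin y x0) : y' x0 = 0 ∧ 0 ≤ y'' := by
  have hd : y' x0 = 0 := hm.hasDerivAt_eq_zero (h1 x0)
  refine ⟨hd, ?_⟩
  by_contra hneg
  push Not at hneg
  have e : deriv y = y' := funext fun x => (h1 x).deriv
  have hmax : IsLocalMax y x0 := by
    apply isLocalMax_of_deriv_deriv_neg
    · rw [e, h2.deriv]; exact hneg
    · rw [e, hd]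
    · exact (h1 x0).continuousAt
  have hconst : y =ᶠ[nhds x0] fun _ => y x0 := by
    filter_upwards [hm, hmax] with x ha hb
    exact le_antisymm hb ha
  have h3 : deriv y =ᶠ[nhds x0] deriv (fun _ => y x0) := hconst.deriv
  have h4 : y' =ᶠ[nhds x0] fun _ => (0:ℝ) := by
    rw [e] at h3
    filter_upwards [h3] with x hx
    rw [hx]; simp
  have h5 := h4.deriv_eq
  rw [h2.deriv] at h5
  simp at h5
  linarith

lemma aux_decay {y y' : ℝ → ℝ} {k x0 : ℝ} (h1 : ∀ x, HasDerivAt y (y' x) x)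
    (h : ∀ x, x0 ≤ x → y' x ≤ k * y x) (h0 : y x0 ≤ 0) : ∀ x, x0 ≤ x → y x ≤ 0 := by
  have hd : ∀ x, HasDerivAt (fun x => Real.exp (-k * x) * y x)
      (Real.exp (-k * x) * (y' x - k * y x)) x := by
    intro x
    have := (((hasDerivAt_id x).const_mul (-k)).exp).mul (h1 x)
    refine this.congr_deriv ?_
    simp only [id, mul_one]; ring
  have ha : AntitoneOn (fun x => Real.exp (-k * x) * y x) (Set.Ici x0) := by
    apply antitoneOn_of_deriv_nonpos (convex_Ici x0)
    · exact fun x _ => (hd x).continuousAt.continuousWithinAt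
    · exact fun x _ => (hd x).differentiableAt.differentiableWithinAt
    · intro x hx
      rw [interior_Ici] at hx
      rw [(hd x).deriv]
      have := h x hx.le
      exact mul_nonpos_of_nonneg_of_nonpos (Real.exp_pos _).le (by linarith)
  intro x hx
  have h2 := ha (Set.self_mem_Ici) hx hx
  try simp only at h2
  have h3 : Real.exp (-k * x) * y x ≤ 0 :=
    h2.trans (mul_nonpos_of_nonneg_of_nonpos (Real.exp_pos _).le h0)
  by_contra hc
  push Not at hc
  have := mul_pos (Real.exp_pos (-k * x)) hc
  linarith

lemma aux_strong {y y' y'' : ℝ → ℝ} {c K x0 : ℝ} (hK : 0 ≤ K)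
    (h1 : ∀ x, HasDerivAt y (y' x) x) (h2 : ∀ x, HasDerivAt y' (y'' x) x)
    (hpos : ∀ x, 0 ≤ y x) (h : ∀ x, y'' x + c * y' x ≤ K * y x) (h0 : y x0 = 0) :
    ∀ x, x0 ≤ x → y x = 0 := by
  have hm : IsLocalMin y x0 := Eventually.of_forall fun x => by
    rw [h0]; exact hpos x
  have hd := (aux_second h1 (h2 x0) hm).1
  set s := Real.sqrt (c ^ 2 + 4 * K) with hs
  have hs2 : s ^ 2 = c ^ 2 + 4 * K := Real.sq_sqrt (by positivity)
  have hw := aux_decay (y := fun x => y' x - ((-c - s) / 2) * y x)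
    (y' := fun x => y'' x - ((-c - s) / 2) * y' x) (k := (-c + s) / 2) (x0 := x0)
    (fun x => (h2 x).sub ((h1 x).const_mul _)) (by
      intro x _
      have := h x
      try simp only
      have e : (-c + s) / 2 * (y' x - (-c - s) / 2 * y x)
        = (-c + s) / 2 * y' x + (s^2 - c^2) / 4 * y x := by ring
      rw [e, hs2]
      linarith) (by simp [hd, h0])
  intro x hx
  refine le_antisymm ?_ (hpos x)
  exact aux_decay (k := (-c - s) / 2) h1 (fun x hx => by have := hw x hx; (try simp only at this); linarith) h0.le x hx

lemma aux_left {c σ N : ℝ} {z1 z1' z1'' z2 z2' z2'' A B C D g1 g2 : ℝ → ℝ} (hσ : 0 < σ)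
    (h1 : ∀ x, HasDerivAt z1 (z1' x) x) (h1' : ∀ x, HasDerivAt z1' (z1'' x) x)
    (h2 : ∀ x, HasDerivAt z2 (z2' x) x) (h2' : ∀ x, HasDerivAt z2' (z2'' x) x)
    (e1 : ∀ x, z1'' x + c * z1' x + A x * z1 x + B x * z2 x ≤ 0)
    (e2 : ∀ x, σ * z2'' x + c * z2' x + C x * z1 x + D x * z2 x ≤ 0)
    (hB : ∀ x, 0 ≤ B x) (hC : ∀ x, 0 ≤ C x)
    (hAB : ∀ x ≤ N, A x + B x < 0) (hCD : ∀ x ≤ N, C x + D x < 0)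
    (hN1 : 0 ≤ z1 N) (hN2 : 0 ≤ z2 N)
    (hg1 : ∀ x, g1 x ≤ z1 x) (hg2 : ∀ x, g2 x ≤ z2 x)
    (t1 : Tendsto g1 atBot (nhds 0)) (t2 : Tendsto g2 atBot (nhds 0)) :
    ∀ x ≤ N, 0 ≤ z1 x ∧ 0 ≤ z2 x := by
  by_contra hcon
  push Not at hcon
  obtain ⟨y, hyN, hy⟩ := hcon
  set f : ℝ → ℝ := fun x => min (z1 x) (z2 x) with hf
  have hfy : f y < 0 := by
    simp only [hf, min_lt_iff]
    by_contra hh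
    push Not at hh
    exact absurd (hy hh.1) (not_lt.2 hh.2)
  have cz1 : Continuous z1 := continuous_iff_continuousAt.2 fun x => (h1 x).continuousAt
  have cz2 : Continuous z2 := continuous_iff_continuousAt.2 fun x => (h2 x).continuousAt
  have cf : Continuous f := cz1.min cz2
  have hev : ∀ᶠ x in atBot, f y < f x := by
    filter_upwards [t1.eventually (lt_mem_nhds hfy), t2.eventually (lt_mem_nhds hfy)] with x ha hb
    exact lt_min (ha.trans_le (hg1 x)) (hb.trans_le (hg2 x))
  obtain ⟨L, hL⟩ := eventually_atBot.1 hev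
  have hLy : L < y := by
    by_contra hh
    push Not at hh
    exact lt_irrefl _ (hL y hh)
  obtain ⟨x0, hx0, hmin⟩ := isCompact_Icc.exists_isMinOn (s := Set.Icc L N)
    ⟨y, hLy.le, hyN⟩ cf.continuousOn
  have hx0y : f x0 ≤ f y := hmin ⟨hLy.le, hyN⟩
  have hall : ∀ x ≤ N, f x0 ≤ f x := by
    intro x hx
    by_cases hxL : L ≤ x
    · exact hmin ⟨hxL, hx⟩
    · exact hx0y.trans (hL x (not_le.1 hxL).le).le
  have hx0N : x0 < N := by
    refine lt_of_le_of_ne hx0.2 ?_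
    rintro rfl
    have : 0 ≤ f x0 := le_min hN1 hN2
    linarith
  have hneg : f x0 < 0 := by linarith
  have hle1 : f x0 ≤ z1 x0 := min_le_left _ _
  have hle2 : f x0 ≤ z2 x0 := min_le_right _ _
  have hnear : ∀ᶠ x in nhds x0, x ≤ N := (gt_mem_nhds hx0N).mono fun x hx => le_of_lt hx
  rcases min_choice (z1 x0) (z2 x0) with hc | hc
  · have hc' : f x0 = z1 x0 := hc
    have hm : IsLocalMin z1 x0 := by
      filter_upwards [hnear] with x hx
      rw [← hc']
      exact (hall x hx).trans (min_le_left _ _)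
    obtain ⟨p, q⟩ := aux_second h1 (h1' x0) hm
    have := e1 x0
    rw [p, ← hc'] at this
    have k1 : B x0 * f x0 ≤ B x0 * z2 x0 := mul_le_mul_of_nonneg_left hle2 (hB x0)
    have k2 := mul_pos_of_neg_of_neg (hAB x0 hx0.2) hneg
    nlinarith
  · have hc' : f x0 = z2 x0 := hc
    have hm : IsLocalMin z2 x0 := by
      filter_upwards [hnear] with x hx
      rw [← hc']
      exact (hall x hx).trans (min_le_right _ _)
    obtain ⟨p, q⟩ := aux_second h2 (h2' x0) hm
    have := e2 x0
    rw [p, ← hc'] at this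
    have k1 : C x0 * f x0 ≤ C x0 * z1 x0 := mul_le_mul_of_nonneg_left hle1 (hC x0)
    have k2 := mul_pos_of_neg_of_neg (hCD x0 hx0.2) hneg
    have k3 := mul_nonneg hσ.le q
    nlinarith

/-- Cooperative comparison: no solution that is positive somewhere. -/
lemma aux_core {c σ N K lam : ℝ}
    {P P' P'' Q Q' Q'' u u' u'' w w' w'' A B C D : ℝ → ℝ} (hσ : 0 < σ) (hK : 0 ≤ K)
    (hlam : 0 ≤ lam)
    (hP1 : ∀ x, HasDerivAt P (P' x) x) (hP2 : ∀ x, HasDerivAt P' (P'' x) x)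
    (hQ1 : ∀ x, HasDerivAt Q (Q' x) x) (hQ2 : ∀ x, HasDerivAt Q' (Q'' x) x)
    (hu1 : ∀ x, HasDerivAt u (u' x) x) (hu2 : ∀ x, HasDerivAt u' (u'' x) x)
    (hw1 : ∀ x, HasDerivAt w (w' x) x) (hw2 : ∀ x, HasDerivAt w' (w'' x) x)
    (hP : ∀ x, 0 < P x) (hQ : ∀ x, 0 < Q x)
    (eP : ∀ x, P'' x + c * P' x + A x * P x + B x * Q x = 0)
    (eQ : ∀ x, σ * Q'' x + c * Q' x + C x * P x + D x * Q x = 0)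
    (eu : ∀ x, u'' x + c * u' x + A x * u x + B x * w x = lam * u x)
    (ew : ∀ x, σ * w'' x + c * w' x + C x * u x + D x * w x = lam * w x)
    (hB : ∀ x, 0 ≤ B x) (hC : ∀ x, 0 ≤ C x)
    (hAB : ∀ x ≤ N, A x + B x < 0) (hCD : ∀ x ≤ N, C x + D x < 0)
    (hAK : ∀ x, lam - A x ≤ K) (hDK : ∀ x, lam - D x ≤ K)
    (tu : Tendsto u atBot (nhds 0)) (tw : Tendsto w atBot (nhds 0))
    (su : Tendsto (fun x => u x / P x) atTop (nhds 0))
    (sw : Tendsto (fun x => w x / Q x) atTop (nhds 0))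
    (hpos : ∃ y, 0 < u y ∨ 0 < w y) : False := by
  -- differential inequality for any multiple
  have ez1 : ∀ M, 0 ≤ M → ∀ x, (M * P'' x - u'' x) + c * (M * P' x - u' x)
      + (A x - lam) * (M * P x - u x) + B x * (M * Q x - w x) ≤ 0 := by
    intro M hM x
    have h1 := eP x
    have h2 := eu x
    have h3 : 0 ≤ lam * (M * P x) := mul_nonneg hlam (mul_nonneg hM (hP x).le)
    have h4 : M * (P'' x + c * P' x + A x * P x + B x * Q x) = 0 := by rw [h1, mul_zero]
    linarith
  have ez2 : ∀ M, 0 ≤ M → ∀ x, σ * (M * Q'' x - w'' x) + c * (M * Q' x - w' x)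
      + C x * (M * P x - u x) + (D x - lam) * (M * Q x - w x) ≤ 0 := by
    intro M hM x
    have h1 := eQ x
    have h2 := ew x
    have h3 : 0 ≤ lam * (M * Q x) := mul_nonneg hlam (mul_nonneg hM (hQ x).le)
    have h4 : M * (σ * Q'' x + c * Q' x + C x * P x + D x * Q x) = 0 := by rw [h1, mul_zero]
    linarith
  have d1 : ∀ M x, HasDerivAt (fun x => M * P x - u x) (M * P' x - u' x) x :=
    fun M x => ((hP1 x).const_mul M).sub (hu1 x)
  have d1' : ∀ M x, HasDerivAt (fun x => M * P' x - u' x) (M * P'' x - u'' x) x :=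
    fun M x => ((hP2 x).const_mul M).sub (hu2 x)
  have d2 : ∀ M x, HasDerivAt (fun x => M * Q x - w x) (M * Q' x - w' x) x :=
    fun M x => ((hQ1 x).const_mul M).sub (hw1 x)
  have d2' : ∀ M x, HasDerivAt (fun x => M * Q' x - w' x) (M * Q'' x - w'' x) x :=
    fun M x => ((hQ2 x).const_mul M).sub (hw2 x)
  have left : ∀ M, 0 ≤ M → u N ≤ M * P N → w N ≤ M * Q N →
      ∀ x ≤ N, u x ≤ M * P x ∧ w x ≤ M * Q x := by
    intro M hM a1 a2
    have := aux_left (N := N) (A := fun x => A x - lam) (D := fun x => D x - lam)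
      (g1 := fun x => -u x) (g2 := fun x => -w x)
      hσ (d1 M) (d1' M) (d2 M) (d2' M) (ez1 M hM) (ez2 M hM) hB hC
      (fun x hx => by have := hAB x hx; linarith)
      (fun x hx => by have := hCD x hx; linarith)
      (by simpa using a1) (by simpa using a2)
      (fun x => by have := mul_nonneg hM (hP x).le; linarith)
      (fun x => by have := mul_nonneg hM (hQ x).le; linarith)
      (by simpa using tu.neg) (by simpa using tw.neg)
    intro x hx
    have h := this x hx
    try simp only at h
    exact ⟨by linarith [h.1], by linarith [h.2]⟩
  set s : ℝ → ℝ := fun x => max (u x / P x) (w x / Q x) with hs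
  have key : ∀ M x, s x ≤ M ↔ u x ≤ M * P x ∧ w x ≤ M * Q x := by
    intro M x
    simp only [hs, max_le_iff, div_le_iff₀ (hP x), div_le_iff₀ (hQ x)]
  have cont : ∀ {f f' : ℝ → ℝ}, (∀ x, HasDerivAt f (f' x) x) → Continuous f :=
    fun h => continuous_iff_continuousAt.2 fun x => (h x).continuousAt
  have cs : Continuous s :=
    ((cont hu1).div (cont hP1) fun x => (hP x).ne').max
      ((cont hw1).div (cont hQ1) fun x => (hQ x).ne')
  obtain ⟨y, hy⟩ := hpos
  have hsy : 0 < s y := by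
    rcases hy with h | h
    · exact lt_max_of_lt_left (div_pos h (hP y))
    · exact lt_max_of_lt_right (div_pos h (hQ y))
  have leftS : ∀ x ≤ N, s x ≤ max (s N) 0 := by
    intro x hx
    have h := (key (max (s N) 0) N).1 (le_max_left _ _)
    exact (key _ _).2 (left _ (le_max_right _ _) h.1 h.2 x hx)
  have hev : ∀ᶠ x in atTop, s x < s y := by
    filter_upwards [su.eventually (gt_mem_nhds hsy), sw.eventually (gt_mem_nhds hsy)] with x ha hb
    exact max_lt ha hb
  obtain ⟨R, hR⟩ := eventually_atTop.1 hev
  have hyR : y < R := by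
    by_contra hh
    exact lt_irrefl _ (hR y (not_lt.1 hh))
  obtain ⟨x0, hx0, hmax⟩ := isCompact_Icc.exists_isMaxOn (s := Set.Icc N (max N R))
    ⟨N, le_rfl, le_max_left _ _⟩ cs.continuousOn
  have hNs : s N ≤ s x0 := hmax ⟨le_rfl, le_max_left _ _⟩
  have hyx0 : s y ≤ s x0 := by
    by_cases hyN : y ≤ N
    · have h1 := leftS y hyN
      rcases max_choice (s N) 0 with h | h
      · rw [h] at h1; linarith
      · rw [h] at h1; linarith
    · exact hmax ⟨(not_le.1 hyN).le, hyR.le.trans (le_max_right _ _)⟩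
  have hM : 0 < s x0 := by linarith
  have hall : ∀ x, s x ≤ s x0 := by
    intro x
    rcases le_total x N with h | h
    · exact (leftS x h).trans (max_le hNs hM.le)
    · rcases le_total x R with h' | h'
      · exact hmax ⟨h, h'.trans (le_max_right _ _)⟩
      · exact (hR x h').le.trans hyx0
  set M := s x0 with hMdef
  have z1 : ∀ x, 0 ≤ M * P x - u x := fun x => by linarith [((key M x).1 (hall x)).1]
  have z2 : ∀ x, 0 ≤ M * Q x - w x := fun x => by linarith [((key M x).1 (hall x)).2]
  rcases max_choice (u x0 / P x0) (w x0 / Q x0) with h | h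
  · have h' : M = u x0 / P x0 := h
    have hz : M * P x0 - u x0 = 0 := by rw [h']; field_simp [(hP x0).ne']; ring
    have := aux_strong (c := c) hK (d1 M) (d1' M) z1 (by
      intro x
      have e := ez1 M hM.le x
      have k1 := mul_nonneg (hB x) (z2 x)
      have k2 := mul_le_mul_of_nonneg_right (hAK x) (z1 x)
      linarith) hz
    have ev : (fun x => u x / P x) =ᶠ[atTop] fun _ => M := by
      filter_upwards [eventually_ge_atTop x0] with x hx
      have := this x hx
      try simp only at this
      rw [div_eq_iff (hP x).ne']; linarith
    have := tendsto_nhds_unique (su.congr' ev) tendsto_const_nhds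
    linarith
  · have h' : M = w x0 / Q x0 := h
    have hz : M * Q x0 - w x0 = 0 := by rw [h']; field_simp [(hQ x0).ne']; ring
    have := aux_strong (c := c / σ) (K := K / σ) (by positivity) (d2 M) (d2' M) z2 (by
      intro x
      have e := ez2 M hM.le x
      have k1 := mul_nonneg (hC x) (z1 x)
      have k2 := mul_le_mul_of_nonneg_right (hDK x) (z2 x)
      rw [div_mul_eq_mul_div, div_mul_eq_mul_div, ← sub_nonneg]
      have : K * (M * Q x - w x) / σ - (M * Q'' x - w'' x + c * (M * Q' x - w' x) / σ)
        = (K * (M * Q x - w x) - (σ * (M * Q'' x - w'' x) + c * (M * Q' x - w' x))) / σ := by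
        field_simp
      rw [this]
      apply div_nonneg _ hσ.le
      linarith) hz
    have ev : (fun x => w x / Q x) =ᶠ[atTop] fun _ => M := by
      filter_upwards [eventually_ge_atTop x0] with x hx
      have := this x hx
      try simp only at this
      rw [div_eq_iff (hQ x).ne']; linarith
    have := tendsto_nhds_unique (sw.congr' ev) tendsto_const_nhds
    linarith

lemma aux_c2 {f : ℝ → ℝ} (h : ContDiff ℝ 2 f) :
    (∀ x, HasDerivAt f (deriv f x) x) ∧ ∀ x, HasDerivAt (deriv f) (deriv (deriv f) x) x := by
  refine ⟨fun x => (h.differentiable (by norm_num) x).hasDerivAt, fun x => ?_⟩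
  have h' : ContDiff ℝ (1 + 1) f := by norm_num; exact h
  have := (contDiff_succ_iff_deriv.1 h').2.2
  exact (this.differentiable (by norm_num) x).hasDerivAt

lemma aux_ratio {v ω P : ℝ → ℝ} {γ β : ℝ} (hβ : 0 < β)
    (hω : ∀ x ≥ (1:ℝ), ω x = Real.exp (-γ * x))
    (hP : Tendsto (fun x => Real.exp (γ * x) * P x / x) atTop (nhds β))
    (hv : Tendsto (fun x => v x / ω x) atTop (nhds 0)) :
    Tendsto (fun x => v x / P x) atTop (nhds 0) := by
  have h := (hv.mul (hP.inv₀ hβ.ne')).mul (tendsto_inv_atTop_zero (𝕜 := ℝ))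
  simp only [zero_mul] at h
  refine h.congr' ?_
  filter_upwards [eventually_ge_atTop 1] with x hx
  have hx0 : x ≠ 0 := by linarith
  rw [hω x hx, neg_mul, Real.exp_neg]
  have := (Real.exp_pos (γ * x)).ne'
  by_cases hPx : P x = 0
  · simp [hPx]
  field_simp

/-- Lemma B.2: any real eigenvalue of the weighted linearization about the
critical pulled front is strictly negative. -/
theorem real_eigenvalues_negative
    -- parameters
    (a b σ r : ℝ)
    (ha0 : 0 < a) (ha1 : a < 1) (hb : 1 < b) (hr : 0 < r)
    (hσ0 : 0 < σ) (hσ2 : σ < 2)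
    (hpar : (a * b - max 1 (2 * (1 - a))) * r ≤ max 1 (2 * (1 - a)) * (2 - σ) * (1 - a))
    (γ c δ : ℝ)
    (hγ : γ = Real.sqrt (1 - a)) (hc : c = 2 * γ)
    (hδ0 : 0 < δ)
    (hδ : δ < min (-γ + Real.sqrt (γ ^ 2 + 1))
        ((-γ + Real.sqrt (γ ^ 2 + σ * r * (b - 1))) / σ))
    -- the weight
    (ω : ℝ → ℝ) (hωsmooth : ContDiff ℝ (⊤ : ℕ∞) ω) (hωpos : ∀ x, 0 < ω x)
    (hωright : ∀ x ≥ (1:ℝ), ω x = Real.exp (-γ * x))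
    (hωleft : ∀ x ≤ (-1:ℝ), ω x = Real.exp (δ * x))
    -- the critical pulled front
    (U V : ℝ → ℝ) (hUreg : ContDiff ℝ 2 U) (hVreg : ContDiff ℝ 2 V)
    (hUode : ∀ x, deriv (deriv U) x + c * deriv U x + U x * (1 - U x - a * V x) = 0)
    (hVode : ∀ x, σ * deriv (deriv V) x + c * deriv V x + r * V x * (1 - b * U x - V x) = 0)
    (hlimbot : Tendsto (fun x => (U x, V x)) atBot (nhds (1, 0)))
    (hlimtop : Tendsto (fun x => (U x, V x)) atTop (nhds (0, 1)))
    (hU01 : ∀ x, 0 < U x ∧ U x < 1) (hV01 : ∀ x, 0 < V x ∧ V x < 1)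
    (hUdec : ∀ x, deriv U x < 0) (hVinc : ∀ x, 0 < deriv V x)
    -- weak exponential asymptotics of the derivative of the front at +∞
    (hasymp : ∃ β₁ β₂ : ℝ, 0 < β₁ ∧ 0 < β₂ ∧
      Tendsto (fun x => Real.exp (γ * x) * (-deriv U x) / x) atTop (nhds β₁) ∧
      Tendsto (fun x => Real.exp (γ * x) * deriv V x / x) atTop (nhds β₂))
    -- a nontrivial bounded, weighted-decaying eigenfunction with real eigenvalue λ
    (lam : ℝ) (v₁ v₂ : ℝ → ℝ) (hv₁reg : ContDiff ℝ 2 v₁) (hv₂reg : ContDiff ℝ 2 v₂)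
    (hnontriv : ¬∀ x : ℝ, v₁ x = 0 ∧ v₂ x = 0)
    (heq₁ : ∀ x, deriv (deriv v₁) x + c * deriv v₁ x
      + (1 - 2 * U x - a * V x) * v₁ x - a * U x * v₂ x = lam * v₁ x)
    (heq₂ : ∀ x, σ * deriv (deriv v₂) x + c * deriv v₂ x
      - r * b * V x * v₁ x + r * (1 - b * U x - 2 * V x) * v₂ x = lam * v₂ x)
    (hbdd : ∃ B : ℝ, ∀ x, |v₁ x / ω x| ≤ B ∧ |v₂ x / ω x| ≤ B)
    (hlim₁top : Tendsto (fun x => v₁ x / ω x) atTop (nhds 0))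
    (hlim₁bot : Tendsto (fun x => v₁ x / ω x) atBot (nhds 0))
    (hlim₂top : Tendsto (fun x => v₂ x / ω x) atTop (nhds 0))
    (hlim₂bot : Tendsto (fun x => v₂ x / ω x) atBot (nhds 0)) :
    lam < 0 := by
  by_contra hneg
  have hlam : 0 ≤ lam := not_lt.1 hneg
  obtain ⟨β₁, β₂, hβ₁, hβ₂, as1, as2⟩ := hasymp
  obtain ⟨U1, U2⟩ := aux_c2 hUreg
  obtain ⟨V1, V2⟩ := aux_c2 hVreg
  obtain ⟨p1, p2⟩ := aux_c2 hv₁reg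
  obtain ⟨q1, q2⟩ := aux_c2 hv₂reg
  have U3 : ∀ x, HasDerivAt (deriv (deriv U)) (-c * deriv (deriv U) x
      - (deriv U x * (1 - U x - a * V x) + U x * (-deriv U x - a * deriv V x))) x := by
    intro x
    have e : deriv (deriv U) = fun x => -c * deriv U x - U x * (1 - U x - a * V x) := by
      funext x; linarith [hUode x]
    rw [show deriv (deriv U) x = deriv (deriv U) x from rfl]
    have := ((U2 x).const_mul (-c)).sub
      ((U1 x).mul (((U1 x).const_sub 1).sub ((V1 x).const_mul a)))
    exact this.congr_of_eventuallyEq (Eventually.of_forall fun y => by rw [e]; rfl)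
  have V3 : ∀ x, HasDerivAt (deriv (deriv V)) ((-c * deriv (deriv V) x
      - (r * deriv V x * (1 - b * U x - V x) + r * V x * (-(b * deriv U x) - deriv V x))) / σ) x := by
    intro x
    have e : deriv (deriv V) = fun x => (-c * deriv V x - r * V x * (1 - b * U x - V x)) / σ := by
      funext x; rw [eq_div_iff hσ0.ne']; linarith [hVode x]
    have := (((V2 x).const_mul (-c)).sub
      (((V1 x).const_mul r).mul ((((U1 x).const_mul b).const_sub 1).sub (V1 x)))).div_const σ
    exact this.congr_of_eventuallyEq (Eventually.of_forall fun y => by rw [e]; rfl)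
  have tU : Tendsto U atBot (nhds 1) := (continuous_fst.tendsto _).comp hlimbot
  have tV : Tendsto V atBot (nhds 0) := (continuous_snd.tendsto _).comp hlimbot
  have t1 : Tendsto (fun x => (1 - 2 * U x - a * V x) + a * U x) atBot
      (nhds ((1 - 2 * 1 - a * 0) + a * 1)) :=
    ((tendsto_const_nhds.sub (tU.const_mul 2)).sub (tV.const_mul a)).add (tU.const_mul a)
  have t2 : Tendsto (fun x => r * b * V x + r * (1 - b * U x - 2 * V x)) atBot
      (nhds (r * b * 0 + r * (1 - b * 1 - 2 * 0))) :=
    (tV.const_mul _).add (((tendsto_const_nhds.sub (tU.const_mul b)).sub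
      (tV.const_mul 2)).const_mul r)
  have hneg2 : r * b * 0 + r * (1 - b * 1 - 2 * 0) < 0 := by nlinarith
  obtain ⟨N, hN⟩ := eventually_atBot.1 ((t1.eventually (gt_mem_nhds
    (show (1 - 2 * 1 - a * 0) + a * 1 < 0 by linarith))).and (t2.eventually (gt_mem_nhds hneg2)))
  have tω : Tendsto ω atBot (nhds 0) := by
    have : Tendsto (fun x => Real.exp (δ * x)) atBot (nhds 0) :=
      Real.tendsto_exp_atBot.comp (tendsto_id.const_mul_atBot hδ0)
    refine this.congr' ?_
    filter_upwards [eventually_le_atBot (-1)] with x hx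
    exact (hωleft x hx).symm
  have tv : ∀ v : ℝ → ℝ, Tendsto (fun x => v x / ω x) atBot (nhds 0) →
      Tendsto v atBot (nhds 0) := by
    intro v hv
    have := hv.mul tω
    rw [zero_mul] at this
    exact this.congr fun x => div_mul_cancel₀ _ (hωpos x).ne'
  have s1 := aux_ratio hβ₁ hωright as1 hlim₁top
  have s2 := aux_ratio hβ₂ hωright as2 hlim₂top
  have w1 := tv _ hlim₁bot
  have w2 := tv _ hlim₂bot
  have main : ∀ ε : ℝ, (∃ y, 0 < ε * v₁ y ∨ 0 < -ε * v₂ y) → False := by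
    intro ε hpos
    refine aux_core (c := c) (σ := σ) (N := N) (K := lam + 2 + r * (b + 2)) (lam := lam)
      (P := fun x => -deriv U x) (Q := deriv V) (u := fun x => ε * v₁ x) (w := fun x => -ε * v₂ x)
      (A := fun x => 1 - 2 * U x - a * V x) (B := fun x => a * U x)
      (C := fun x => r * b * V x) (D := fun x => r * (1 - b * U x - 2 * V x))
      hσ0 (by positivity) hlam (fun x => (U2 x).neg) (fun x => (U3 x).neg) V2 V3
      (fun x => (p1 x).const_mul ε) (fun x => (p2 x).const_mul ε)
      (fun x => (q1 x).const_mul (-ε)) (fun x => (q2 x).const_mul (-ε))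
      (fun x => neg_pos.2 (hUdec x)) hVinc ?_ ?_ ?_ ?_
      (fun x => mul_nonneg ha0.le (hU01 x).1.le)
      (fun x => mul_nonneg (by positivity) (hV01 x).1.le)
      (fun x hx => (hN x hx).1) (fun x hx => (hN x hx).2) ?_ ?_ ?_ ?_ ?_ ?_ hpos
    · intro x; ring
    · intro x; field_simp; ring
    · intro x; linear_combination ε * heq₁ x
    · intro x; linear_combination (-ε) * heq₂ x
    · intro x
      have := (hU01 x).2
      have := mul_lt_mul_of_pos_left (hV01 x).2 ha0
      have : 0 < r * (b + 2) := by positivity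
      try simp only
      linarith
    · intro x
      have k1 := mul_lt_mul_of_pos_left (hU01 x).2 (show 0 < r * b by positivity)
      have k2 := mul_lt_mul_of_pos_left (hV01 x).2 hr
      try simp only
      linarith
    · simpa using w1.const_mul ε
    · simpa using w2.const_mul (-ε)
    · have := s1.const_mul ε
      rw [mul_zero] at this
      exact this.congr fun x => by ring
    · have := s2.const_mul (-ε)
      rw [mul_zero] at this
      exact this.congr fun x => by ring
  apply hnontriv
  intro x
  constructor
  · by_contra h
    rcases lt_or_gt_of_ne h with h | h
    · exact main (-1) ⟨x, Or.inl (by linarith)⟩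
    · exact main 1 ⟨x, Or.inl (by linarith)⟩
  · by_contra h
    rcases lt_or_gt_of_ne h with h | h
    · exact main 1 ⟨x, Or.inr (by linarith)⟩
    · exact main (-1) ⟨x, Or.inr (by linarith)⟩
end

section
/- Large-time weighted kernel estimate: let t ≥ 1 and K, κ, r, C > 0, and let G : ℝ × ℝ → ℝ be measurable satisfying |G(x, y)| ≤ C·t^{−1/2}·e^{−(x−y)²/(κt)} whenever |x − y| ≥ Kt, and |G(x, y)| ≤ C·((1 + |x − y|)·t^{−3/2}·e^{−(x−y)²/(κt)} + e^{−rt}) whenever |x − y| ≤ Kt. Then there exists a constant C' > 0, depending only on C, κ, r, K (and not on t, x, G, h), such that for every measurable h : ℝ → ℝ with ∫_ℝ (1 + |y|)|h(y)| dy < ∞ and every x ∈ ℝ, |∫_ℝ G(x, y)h(y) dy| ≤ C'·(1 + |x|)·(1 + t)^{−3/2}·∫_ℝ (1 + |y|)|h(y)| dy. -/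
open MeasureTheory

/-- Large-time weighted kernel estimate: the Green's function bounds of
Proposition 4.1 yield the weighted `(1+|x|)(1+t)^{-3/2}` decay. -/
theorem large_time_kernel_estimate
    (C κ r K : ℝ) (hC : 0 < C) (hκ : 0 < κ) (hr : 0 < r) (hK : 0 < K) :
    ∃ C' > (0:ℝ), ∀ t : ℝ, 1 ≤ t →
      ∀ G : ℝ → ℝ → ℝ, Measurable (Function.uncurry G) →
      (∀ x y : ℝ, K * t ≤ |x - y| →
        |G x y| ≤ C * t ^ (-(1 : ℝ) / 2) * Real.exp (-(x - y) ^ 2 / (κ * t))) →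
      (∀ x y : ℝ, |x - y| ≤ K * t →
        |G x y| ≤ C * ((1 + |x - y|) * t ^ (-(3 : ℝ) / 2) * Real.exp (-(x - y) ^ 2 / (κ * t))
          + Real.exp (-r * t))) →
      ∀ h : ℝ → ℝ, Measurable h → Integrable (fun y => (1 + |y|) * |h y|) →
      ∀ x : ℝ,
        |∫ y : ℝ, G x y * h y|
          ≤ C' * (1 + |x|) * (1 + t) ^ (-(3 : ℝ) / 2) * ∫ y : ℝ, (1 + |y|) * |h y| := by
  refine ⟨C * (1 / K + 1 + 2 / r ^ 2) * (2:ℝ) ^ ((3:ℝ) / 2), by positivity, ?_⟩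
  intro t ht G hG hfar hnear h hh hint x
  have ht0 : 0 < t := by linarith
  set s : ℝ := t ^ (-(3 : ℝ) / 2) with hs
  have hs0 : 0 < s := Real.rpow_pos_of_pos ht0 _
  have hst : s ≤ (2:ℝ) ^ ((3:ℝ) / 2) * (1 + t) ^ (-(3 : ℝ) / 2) := by
    have h1 : (2 * t) ^ (-(3 : ℝ) / 2) ≤ (1 + t) ^ (-(3 : ℝ) / 2) :=
      Real.rpow_le_rpow_of_nonpos (by linarith) (by linarith) (by norm_num)
    rw [Real.mul_rpow (by norm_num) ht0.le] at h1
    have h2 : (2:ℝ) ^ ((3:ℝ) / 2) * (2:ℝ) ^ (-(3:ℝ) / 2) = 1 := by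
      rw [← Real.rpow_add (by norm_num)]; norm_num
    calc s = (2:ℝ) ^ ((3:ℝ) / 2) * ((2:ℝ) ^ (-(3:ℝ) / 2) * s) := by
          rw [← mul_assoc, h2, one_mul]
      _ ≤ _ := by gcongr
  have hhalf : t ^ (-(1 : ℝ) / 2) = t * s := by
    have h3 := Real.rpow_add ht0 1 (-(3:ℝ) / 2)
    rw [Real.rpow_one] at h3
    rw [hs, ← h3]; norm_num
  have hexp : Real.exp (-r * t) ≤ 2 / r ^ 2 * s := by
    have h4 : t ^ (-(2:ℝ)) ≤ s :=
      Real.rpow_le_rpow_of_exponent_le ht (by norm_num)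
    have h5 : t ^ (-(2:ℝ)) = 1 / t ^ 2 := by
      rw [Real.rpow_neg ht0.le]; norm_num
    have h6 := Real.quadratic_le_exp_of_nonneg (x := r * t) (by positivity)
    have h7 : (r * t) ^ 2 / 2 ≤ Real.exp (r * t) := by
      have : 0 < r * t := by positivity
      linarith
    have h8 : Real.exp (-r * t) ≤ ((r * t) ^ 2 / 2)⁻¹ := by
      rw [neg_mul, Real.exp_neg]
      exact inv_anti₀ (by positivity) h7
    calc Real.exp (-r * t) ≤ ((r * t) ^ 2 / 2)⁻¹ := h8
      _ = 2 / r ^ 2 * (1 / t ^ 2) := by field_simp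
      _ ≤ _ := by rw [← h5]; gcongr
  have hpt : ∀ y, |G x y| ≤ C * (1 / K + 1 + 2 / r ^ 2) * s * ((1 + |x|) * (1 + |y|)) := by
    intro y
    have hE : Real.exp (-(x - y) ^ 2 / (κ * t)) ≤ 1 := by
      rw [Real.exp_le_one_iff, neg_div]
      have : 0 ≤ (x - y) ^ 2 / (κ * t) := by positivity
      linarith
    have hE0 := Real.exp_pos (-(x - y) ^ 2 / (κ * t))
    set E := Real.exp (-(x - y) ^ 2 / (κ * t))
    have hxy : 1 + |x - y| ≤ (1 + |x|) * (1 + |y|) := by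
      have h1 := abs_sub x y
      nlinarith [abs_nonneg x, abs_nonneg y, mul_nonneg (abs_nonneg x) (abs_nonneg y)]
    have hone : 1 ≤ (1 + |x|) * (1 + |y|) := by linarith [abs_nonneg (x - y)]
    set W := (1 + |x|) * (1 + |y|)
    have hW : 0 < W := by linarith
    have hsW : 0 < s * W := by positivity
    rcases le_total (K * t) |x - y| with hc | hc
    · have h1 := hfar x y hc
      rw [hhalf] at h1
      have h2 : t ≤ 1 / K * W := by
        rw [one_div, ← div_eq_inv_mul, le_div_iff₀ hK]
        linarith
      calc |G x y| ≤ C * (t * s) * E := h1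
        _ ≤ C * (t * s) * 1 := by gcongr
        _ ≤ C * ((1 / K * W) * s) * 1 := by gcongr
        _ = C * (1 / K) * s * W := by ring
        _ ≤ _ := by
          gcongr
          have : 0 ≤ 2 / r ^ 2 := by positivity
          linarith
    · calc |G x y| ≤ C * ((1 + |x - y|) * s * E + Real.exp (-r * t)) := hnear x y hc
        _ ≤ C * (W * s * 1 + 2 / r ^ 2 * s * W) := by
          gcongr
          exact hexp.trans (le_mul_of_one_le_right (by positivity) hone)
        _ = C * (1 + 2 / r ^ 2) * s * W := by ring
        _ ≤ _ := by
          gcongr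
          have : 0 ≤ 1 / K := by positivity
          linarith
  have hI : 0 ≤ ∫ y : ℝ, (1 + |y|) * |h y| := integral_nonneg fun y => by positivity
  calc |∫ y : ℝ, G x y * h y|
      ≤ ∫ y : ℝ, C * (1 / K + 1 + 2 / r ^ 2) * s * (1 + |x|) * ((1 + |y|) * |h y|) := by
        rw [← Real.norm_eq_abs]
        refine norm_integral_le_of_norm_le (hint.const_mul _) (Filter.Eventually.of_forall ?_)
        intro y
        rw [Real.norm_eq_abs, abs_mul]
        calc |G x y| * |h y| ≤ _ := mul_le_mul_of_nonneg_right (hpt y) (abs_nonneg _)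
          _ = _ := by ring
    _ = C * (1 / K + 1 + 2 / r ^ 2) * s * (1 + |x|) * ∫ y : ℝ, (1 + |y|) * |h y| := by
        rw [integral_const_mul]
    _ ≤ C * (1 / K + 1 + 2 / r ^ 2) * ((2:ℝ) ^ ((3:ℝ) / 2) * (1 + t) ^ (-(3 : ℝ) / 2))
          * (1 + |x|) * ∫ y : ℝ, (1 + |y|) * |h y| := by gcongr
    _ = _ := by ring
end

section
/- Nonlinear bootstrap lemma: let C₁, C₂, Ω > 0 with 4C₁C₂Ω < 1, let T ∈ (0, ∞], and let Θ : [0, T) → ℝ be continuous with Θ(0) < 2C₁Ω and Θ(t) ≤ C₁Ω + C₂·Θ(t)² for all t ∈ [0, T). Then Θ(t) < 2C₁Ω for all t ∈ [0, T). -/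
/-- Nonlinear bootstrap lemma: if `Θ` is continuous on `[0, T)`, starts below
`2C₁Ω`, and satisfies `Θ ≤ C₁Ω + C₂Θ²` with `4C₁C₂Ω < 1`, then `Θ < 2C₁Ω` on `[0, T)`. -/
theorem nonlinear_bootstrap
    (C₁ C₂ Ω : ℝ) (hC₁ : 0 < C₁) (hC₂ : 0 < C₂) (hΩ : 0 < Ω)
    (hsmall : 4 * C₁ * C₂ * Ω < 1)
    (T : ENNReal) (hT : 0 < T)
    (Θ : ℝ → ℝ)
    (hcont : ContinuousOn Θ {t : ℝ | 0 ≤ t ∧ ENNReal.ofReal t < T})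
    (h0 : Θ 0 < 2 * C₁ * Ω)
    (hineq : ∀ t : ℝ, 0 ≤ t → ENNReal.ofReal t < T → Θ t ≤ C₁ * Ω + C₂ * Θ t ^ 2) :
    ∀ t : ℝ, 0 ≤ t → ENNReal.ofReal t < T → Θ t < 2 * C₁ * Ω := by
  intro t ht htT
  by_contra hge
  have hge' : 2 * C₁ * Ω ≤ Θ t := not_lt.mp hge
  have hsub : Set.Icc 0 t ⊆ {t : ℝ | 0 ≤ t ∧ ENNReal.ofReal t < T} := fun s hs =>
    ⟨hs.1, lt_of_le_of_lt (ENNReal.ofReal_le_ofReal hs.2) htT⟩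
  obtain ⟨s, hs, hse⟩ := intermediate_value_Icc ht (hcont.mono hsub) ⟨h0.le, hge'⟩
  have h := hineq s (hsub hs).1 (hsub hs).2
  rw [hse] at h
  have ha : 0 < C₁ * Ω := mul_pos hC₁ hΩ
  have h2 := mul_pos ha (sub_pos.mpr hsmall)
  nlinarith [h, h2]
end
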